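/- There is no embedding of the disjoint union K_{3,3} ⊔ K_{3,3} of two copies of the complete bipartite graph K_{3,3} into the torus T². (This is the graph E₄₂, the unique disconnected cubic obstruction among the six cubic projective plane obstructions.) -/

import Mathlib

/-- The torus `T² = (ℝ/ℤ) × (ℝ/ℤ)`. -/
abbrev Torus := UnitAddCircle × UnitAddCircle

/-- An embedding of a simple graph `G` into the torus: an injective map `vert` on vertices
together with, for each edge `e = {u,v}`, an injective continuous path from `vert u` to
`vert v` meeting the vertex images only at its endpoints, such that the paths of two
distinct edges meet only in images of common endpoints of the two edges. -/
structure TorusEmbedding {V : Type} (G : SimpleGraph V) where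
  vert : V → Torus
  vert_inj : Function.Injective vert
  edge : G.edgeSet → C(unitInterval, Torus)
  edge_ends : ∀ e : G.edgeSet, ∃ u v : V, (e : Sym2 V) = s(u, v) ∧
    edge e 0 = vert u ∧ edge e 1 = vert v
  edge_inj : ∀ e : G.edgeSet, Function.Injective (edge e)
  edge_meets_verts : ∀ (e : G.edgeSet) (t : unitInterval),
    edge e t ∈ Set.range vert → t = 0 ∨ t = 1
  edge_disjoint : ∀ e e' : G.edgeSet, e ≠ e' → ∀ t t' : unitInterval,
    edge e t = edge e' t' →
      ∃ w : V, w ∈ (e : Sym2 V) ∧ w ∈ (e' : Sym2 V) ∧ edge e t = vert w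

/-- The complete bipartite graph `K_{3,3}`. -/
abbrev K33 : SimpleGraph (Fin 3 ⊕ Fin 3) := completeBipartiteGraph (Fin 3) (Fin 3)

/-- The graph `E₄₂ = K_{3,3} ⊔ K_{3,3}`, the disjoint union of two copies of `K_{3,3}`. -/
abbrev E42 : SimpleGraph ((Fin 3 ⊕ Fin 3) ⊕ (Fin 3 ⊕ Fin 3)) := K33 ⊕g K33

open Complex in
theorem TE.exists_log_lift {f : unitInterval × unitInterval → ℂ} (hf : Continuous f)
    (h0 : ∀ x, f x ≠ 0) : ∃ L : unitInterval × unitInterval → ℂ, Continuous L ∧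
      ∀ x, exp (L x) = f x := by
  let pr : ℝ → unitInterval := Set.projIcc 0 1 zero_le_one
  have hpr : Continuous pr := continuous_projIcc
  let F : C(ℝ × ℝ, ℂ) := ⟨fun x => f (pr x.1, pr x.2), by fun_prop⟩
  obtain ⟨G, ⟨_, hG⟩, _⟩ := isCoveringMapOn_exp.existsUnique_continuousMap_lifts F
    (a₀ := (0, 0)) (e₀ := log (F (0, 0))) (exp_log (h0 _)) (fun a => h0 (pr a.1, pr a.2))
  refine ⟨fun x => G (x.1, x.2), by fun_prop, fun x => ?_⟩
  have := congrFun hG ((x.1 : ℝ), (x.2 : ℝ))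
  simp only [Function.comp_apply] at this
  rw [this]
  simp [F, pr, Set.projIcc_val]

open Complex in
theorem TE.diff_eq {u v : unitInterval → ℂ} (hu : Continuous u) (hv : Continuous v) (c : ℂ)
    (h : ∀ t, exp (u t) = c * exp (v t)) : u 1 - u 0 = v 1 - v 0 := by
  have key := isCoveringMap_exp.eq_of_comp_eq (g₁ := fun t => u t - v t)
    (g₂ := fun _ : unitInterval => u 0 - v 0) (by fun_prop) (by fun_prop) (by
      funext t
      apply Subtype.ext
      simp only [Function.comp_apply, exp_sub, h]
      rw [mul_div_cancel_right₀ _ (exp_ne_zero _), mul_div_cancel_right₀ _ (exp_ne_zero _)]) 0 rfl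
  have := congrFun key 1
  linear_combination this

open Complex in
theorem TE.exists_log_path {f : unitInterval → ℂ} (hf : Continuous f)
    (h0 : ∀ x, f x ≠ 0) : ∃ L : unitInterval → ℂ, Continuous L ∧ ∀ x, exp (L x) = f x := by
  obtain ⟨L, hL, h⟩ := TE.exists_log_lift (f := fun x => f x.1) (by fun_prop) (fun x => h0 _)
  exact ⟨fun x => L (x, 0), by fun_prop, fun x => h _⟩

theorem TE.exists_other (j : Fin 3) : ∃ l, j ≠ l := ⟨j + 1, by revert j; decide⟩

open Complex in
theorem TE.planar (A B : Fin 3 → ℂ) (g : ∀ i j, Path (A i) (B j))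
    (h : ∀ i j k l, i ≠ k → j ≠ l → ∀ s t, g i j s ≠ g k l t) : False := by
  have hP0 : ∀ i j k, i ≠ k → ∀ s, g i j s - A k ≠ 0 := by
    intro i j k hik s
    obtain ⟨l, hl⟩ := TE.exists_other j
    have := h i j k l hik hl s 0
    simpa [sub_eq_zero] using this
  have hQ0 : ∀ i j l, j ≠ l → ∀ s, g i j s - B l ≠ 0 := by
    intro i j l hjl s
    obtain ⟨k, hk⟩ := TE.exists_other i
    have := h i j k l hk hjl s 1
    simpa [sub_eq_zero] using this
  have hA : ∀ i k, i ≠ k → A i - A k ≠ 0 := by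
    intro i k hik
    simpa using hP0 i 0 k hik 0
  have hB : ∀ i k, i ≠ k → B i - B k ≠ 0 := by
    intro i k hik
    simpa using hQ0 0 i k hik 1
  have hM : ∀ k j, B j - A k ≠ 0 := by
    intro k j
    obtain ⟨i, hi⟩ := TE.exists_other k
    simpa using hP0 i j k hi.symm 1
  have hlog : ∀ A : Fin 3 → ℂ, (∀ i k, i ≠ k → A i - A k ≠ 0) → ∃ α : Fin 3 → Fin 3 → ℂ,
      (∀ i k, i ≠ k → exp (α i k) = A i - A k) ∧
      ∀ i k, i < k → α k i - α i k = Real.pi * I := by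
    intro A hA
    refine ⟨fun i k => if i < k then log (A i - A k) else log (A k - A i) + Real.pi * I, ?_, ?_⟩
    · intro i k hik
      by_cases hlt : i < k
      · simp only [hlt, if_true]; exact exp_log (hA _ _ hik)
      · simp only [hlt, if_false]
        rw [exp_add, exp_log (hA _ _ hik.symm), exp_pi_mul_I]; ring
    · intro i k hik
      simp [hik, hik.le.not_gt]
  obtain ⟨α, hα, hα'⟩ := hlog A hA
  obtain ⟨β, hβ, hβ'⟩ := hlog B hB
  have hP : ∀ k i j, ∃ n : ℤ, i ≠ k → ∃ u : unitInterval → ℂ, Continuous u ∧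
      (∀ t, exp (u t) = g i j t - A k) ∧
      u 1 - u 0 = log (B j - A k) - α i k + n * (2 * Real.pi * I) := by
    intro k i j
    by_cases hik : i ≠ k
    · obtain ⟨u, hu, hu'⟩ := TE.exists_log_path (f := fun t => g i j t - A k) (by fun_prop)
        (hP0 i j k hik)
      have e : exp (u 1 - u 0) = exp (log (B j - A k) - α i k) := by
        rw [exp_sub, exp_sub, hu', hu', exp_log (hM k j), hα i k hik]; simp
      obtain ⟨n, hn⟩ := exp_eq_exp_iff_exists_int.1 e
      exact ⟨n, fun _ => ⟨u, hu, hu', hn⟩⟩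
    · exact ⟨0, fun hh => absurd hh hik⟩
  have hQ : ∀ l i j, ∃ n : ℤ, j ≠ l → ∃ u : unitInterval → ℂ, Continuous u ∧
      (∀ t, exp (u t) = g i j t - B l) ∧
      u 1 - u 0 = β j l - (log (B l - A i) + Real.pi * I) + n * (2 * Real.pi * I) := by
    intro l i j
    by_cases hik : j ≠ l
    · obtain ⟨u, hu, hu'⟩ := TE.exists_log_path (f := fun t => g i j t - B l) (by fun_prop)
        (hQ0 i j l hik)
      have e : exp (u 1 - u 0) = exp (β j l - (log (B l - A i) + Real.pi * I)) := by
        rw [exp_sub, exp_sub, hu', hu', exp_add, exp_log (hM i l), hβ j l hik, exp_pi_mul_I]; simp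
      obtain ⟨n, hn⟩ := exp_eq_exp_iff_exists_int.1 e
      exact ⟨n, fun _ => ⟨u, hu, hu', hn⟩⟩
    · exact ⟨0, fun hh => absurd hh hik⟩
  choose n hn using hP
  choose m hm using hQ
  have key : ∀ i j k l, i ≠ k → j ≠ l →
      (α k i - α i k) + (β l j - β j l) +
        ((n k i j + m j k l - m l i j - n i k l : ℤ) : ℂ) * (2 * Real.pi * I) = 0 := by
    intro i j k l hik hjl
    obtain ⟨L, hL, hL'⟩ := TE.exists_log_lift
      (f := fun x => g i j x.1 - g k l x.2) (by fun_prop)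
      (fun x => sub_ne_zero.2 (h i j k l hik hjl _ _))
    obtain ⟨u1, c1, e1, d1⟩ := hn k i j hik
    obtain ⟨u2, c2, e2, d2⟩ := hm j k l hjl.symm
    obtain ⟨u3, c3, e3, d3⟩ := hm l i j hjl
    obtain ⟨u4, c4, e4, d4⟩ := hn i k l hik.symm
    have f1 := TE.diff_eq (u := fun t => L (t, 0)) (v := u1) (by fun_prop) c1 1
      (fun t => by simp [hL', e1])
    have f2 := TE.diff_eq (u := fun t => L (1, t)) (v := u2) (by fun_prop) c2 (-1)
      (fun t => by simp [hL', e2])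
    have f3 := TE.diff_eq (u := fun t => L (t, 1)) (v := u3) (by fun_prop) c3 1
      (fun t => by simp [hL', e3])
    have f4 := TE.diff_eq (u := fun t => L (0, t)) (v := u4) (by fun_prop) c4 (-1)
      (fun t => by simp [hL', e4])
    push_cast
    linear_combination -f1 - f2 + f3 + f4 - d1 - d2 + d3 + d4
  have pi0 : (2 * Real.pi * I : ℂ) ≠ 0 := by simp [Real.pi_ne_zero]
  have k1 : ∀ i j k l, i < k → j < l → 1 + n k i j + m j k l - m l i j - n i k l = 0 := by
    intro i j k l hik hjl
    have := key i j k l hik.ne hjl.ne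
    rw [hα' i k hik, hβ' j l hjl] at this
    have h2 : ((1 + n k i j + m j k l - m l i j - n i k l : ℤ) : ℂ) * (2 * Real.pi * I) = 0 := by
      push_cast at this ⊢
      linear_combination this
    have := (mul_eq_zero.1 h2).resolve_right pi0
    exact_mod_cast this
  have k2 : ∀ i j k l, i < k → l < j → n k i j + m j k l - m l i j - n i k l = 0 := by
    intro i j k l hik hjl
    have := key i j k l hik.ne hjl.ne'
    rw [hα' i k hik] at this
    have h3 := hβ' l j hjl
    have h2 : ((n k i j + m j k l - m l i j - n i k l : ℤ) : ℂ) * (2 * Real.pi * I) = 0 := by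
      push_cast at this ⊢
      linear_combination this + h3
    have := (mul_eq_zero.1 h2).resolve_right pi0
    exact_mod_cast this
  have l01 : (0 : Fin 3) < 1 := by decide
  have l02 : (0 : Fin 3) < 2 := by decide
  have l12 : (1 : Fin 3) < 2 := by decide
  have a1 := k1 0 0 1 1 l01 l01
  have a2 := k1 0 0 1 2 l01 l02
  have a3 := k1 0 1 1 2 l01 l12
  have a4 := k1 0 0 2 1 l02 l01
  have a5 := k1 0 0 2 2 l02 l02
  have a6 := k1 0 1 2 2 l02 l12
  have a7 := k1 1 0 2 1 l12 l01
  have a8 := k1 1 0 2 2 l12 l02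
  have a9 := k1 1 1 2 2 l12 l12
  have b1 := k2 0 1 1 0 l01 l01
  have b2 := k2 0 2 1 0 l01 l02
  have b3 := k2 0 2 1 1 l01 l12
  have b4 := k2 0 1 2 0 l02 l01
  have b5 := k2 0 2 2 0 l02 l02
  have b6 := k2 0 2 2 1 l02 l12
  have b7 := k2 1 1 2 0 l12 l01
  have b8 := k2 1 2 2 0 l12 l02
  have b9 := k2 1 2 2 1 l12 l12
  omega

open Complex in
theorem TE.exists_theta : ∃ F : ℝ × ℝ → ℂ, Continuous F ∧
    (∀ (z : ℝ × ℝ) (a b : ℤ), F (z + ((a : ℝ), (b : ℝ))) =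
      exp (2 * Real.pi * I * b * z.1) * F z) ∧
    (∀ z, F z = 0 → ∃ a b : ℤ, z = ((a : ℝ) + 1 / 2, (b : ℝ) + 1 / 2)) := by
  let K : ℝ × ℝ → ℝ → ℂ := fun z f =>
    exp (2 * Real.pi * I * z.1 * (z.2 - f)) * (1 - f + f * exp (2 * Real.pi * I * z.1))
  have hK : ∀ z, K z (Int.fract z.2) = exp (2 * Real.pi * I * z.1 * (⌊z.2⌋ : ℂ)) *
      (1 - (Int.fract z.2 : ℝ) + (Int.fract z.2 : ℝ) * exp (2 * Real.pi * I * z.1)) := by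
    intro z
    have : ((z.2 : ℂ) - (Int.fract z.2 : ℝ)) = (⌊z.2⌋ : ℂ) := by
      rw [← Int.self_sub_floor]; push_cast; ring
    simp only [K, this]
  refine ⟨fun z => K z (Int.fract z.2), ?_, ?_, ?_⟩
  · refine ContinuousOn.comp_fract (f := K) (s := fun z => z.2) ?_ continuous_snd ?_
    · apply Continuous.continuousOn
      simp only [K, Function.uncurry_def]
      fun_prop
    · intro z
      simp only [K]
      push_cast
      simp only [sub_zero, zero_mul, add_zero, mul_one, sub_self, zero_add, one_mul, ← exp_add]
      congr 1
      ring
  · intro z a b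
    simp only [hK]
    have e1 : exp (2 * Real.pi * I * ((z.1 + a : ℝ) : ℂ)) = exp (2 * Real.pi * I * z.1) := by
      rw [exp_eq_exp_iff_exists_int]
      exact ⟨a, by push_cast; ring⟩
    have e2 : exp (2 * Real.pi * I * ((z.1 + a : ℝ) : ℂ) * ((⌊z.2⌋ + b : ℤ) : ℂ)) =
        exp (2 * Real.pi * I * b * z.1) * exp (2 * Real.pi * I * z.1 * (⌊z.2⌋ : ℂ)) := by
      rw [← exp_add, exp_eq_exp_iff_exists_int]
      exact ⟨a * (⌊z.2⌋ + b), by push_cast; ring⟩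
    simp only [Prod.fst_add, Prod.snd_add, Int.fract_add_intCast, Int.floor_add_intCast, e1, e2]
    ring
  · intro z hz
    simp only [hK] at hz
    have h1 := (mul_eq_zero.1 hz).resolve_left (exp_ne_zero _)
    set f := Int.fract z.2 with hf
    have h2 : ((f : ℂ)) * exp (2 * Real.pi * I * z.1) = ((f - 1 : ℝ) : ℂ) := by
      push_cast; linear_combination h1
    have h3 := congrArg norm h2
    have e : ‖exp (2 * Real.pi * I * z.1)‖ = 1 := by
      rw [show (2 * Real.pi * I * z.1 : ℂ) = ((2 * Real.pi * z.1 : ℝ) : ℂ) * I by push_cast; ring]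
      exact norm_exp_ofReal_mul_I _
    rw [norm_mul, e, mul_one, norm_real, norm_real, Real.norm_eq_abs, Real.norm_eq_abs,
      abs_of_nonneg (Int.fract_nonneg _), abs_of_nonpos (by linarith [Int.fract_lt_one z.2])] at h3
    have hf2 : f = 1 / 2 := by linarith
    rw [hf2] at h2
    have h4 : exp (2 * Real.pi * I * z.1) = exp (Real.pi * I) := by
      rw [exp_pi_mul_I]
      push_cast at h2
      linear_combination 2 * h2
    obtain ⟨n, hn⟩ := exp_eq_exp_iff_exists_int.1 h4
    have pi0 : (2 * Real.pi * I : ℂ) ≠ 0 := by simp [Real.pi_ne_zero]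
    have h5 : (z.1 : ℂ) = ((n + 1 / 2 : ℝ) : ℂ) := by
      apply mul_left_cancel₀ pi0
      push_cast
      linear_combination hn
    refine ⟨n, ⌊z.2⌋, Prod.ext (by exact_mod_cast h5) ?_⟩
    simp only
    rw [← hf2, hf]
    exact (Int.floor_add_fract z.2).symm

/-- inclusion of the integer lattice -/
def TE.emb (n : ℤ × ℤ) : ℝ × ℝ := ((n.1 : ℝ), (n.2 : ℝ))

theorem TE.emb_add (n m : ℤ × ℤ) : TE.emb (n + m) = TE.emb n + TE.emb m := by
  simp [TE.emb]

theorem TE.emb_sub (n m : ℤ × ℤ) : TE.emb (n - m) = TE.emb n - TE.emb m := by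
  simp [TE.emb]

theorem TE.emb_neg (n : ℤ × ℤ) : TE.emb (-n) = - TE.emb n := by
  simp [TE.emb]

open Complex in
theorem TE.det_zero (p q : C(unitInterval, ℝ × ℝ)) (m n : ℤ × ℤ)
    (hp : p 1 = p 0 + TE.emb m) (hq : q 1 = q 0 + TE.emb n)
    (hd : ∀ s t, ∀ k : ℤ × ℤ, p s - q t ≠ TE.emb k) : m.1 * n.2 = m.2 * n.1 := by
  obtain ⟨F, hF, hper, hz⟩ := TE.exists_theta
  obtain ⟨L, hL, hL'⟩ := TE.exists_log_lift
    (f := fun x => F (p x.1 - q x.2 + (1 / 2, 1 / 2))) (by fun_prop) (by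
      intro x hx
      obtain ⟨a, b, hab⟩ := hz _ hx
      apply hd x.1 x.2 (a, b)
      have h1 := congrArg Prod.fst hab
      have h2 := congrArg Prod.snd hab
      simp only [Prod.fst_add, Prod.snd_add] at h1 h2
      apply Prod.ext
      · simp only [TE.emb]; linarith
      · simp only [TE.emb]; linarith)
  have f1 := TE.diff_eq (u := fun s => L (s, 1))
    (v := fun s => L (s, 0) - 2 * Real.pi * I * n.2 * (p s).1) (by fun_prop) (by fun_prop)
    (exp (2 * Real.pi * I * (-n.2) * (- (q 0).1 + 1 / 2))) (by
      intro s
      have := hper (p s - q 0 + (1 / 2, 1 / 2)) (-n.1) (-n.2)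
      rw [exp_sub, hL', hL', hq]
      have e : p s - (q 0 + TE.emb n) + (1 / 2, 1 / 2) =
        (p s - q 0 + (1 / 2, 1 / 2)) + (((-n.1 : ℤ) : ℝ), ((-n.2 : ℤ) : ℝ)) := by
        apply Prod.ext <;> simp [TE.emb] <;> ring
      simp only [e, this]
      rw [← mul_div_assoc, eq_div_iff (exp_ne_zero _), mul_right_comm, ← exp_add]
      congr 2
      simp
      ring)
  have f2 := TE.diff_eq (u := fun t => L (1, t))
    (v := fun t => L (0, t) - 2 * Real.pi * I * m.2 * (q t).1) (by fun_prop) (by fun_prop)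
    (exp (2 * Real.pi * I * m.2 * ((p 0).1 + 1 / 2))) (by
      intro t
      have := hper (p 0 - q t + (1 / 2, 1 / 2)) m.1 m.2
      rw [exp_sub, hL', hL', hp]
      have e : p 0 + TE.emb m - q t + (1 / 2, 1 / 2) =
        (p 0 - q t + (1 / 2, 1 / 2)) + ((m.1 : ℝ), (m.2 : ℝ)) := by
        apply Prod.ext <;> simp [TE.emb] <;> ring
      simp only [e, this]
      rw [← mul_div_assoc, eq_div_iff (exp_ne_zero _), mul_right_comm, ← exp_add]
      congr 2
      simp
      ring)
  simp only [hp, hq, TE.emb, Prod.fst_add] at f1 f2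
  push_cast at f1 f2
  have pi0 : (2 * Real.pi * I : ℂ) ≠ 0 := by simp [Real.pi_ne_zero]
  have : (m.1 * n.2 : ℂ) = m.2 * n.1 := by
    apply mul_left_cancel₀ pi0
    linear_combination f1 - f2
  exact_mod_cast this

open Complex in
theorem TE.annulus (A B : Fin 3 → ℝ × ℝ) (N : Fin 3 → Fin 3 → ℤ × ℤ)
    (g : ∀ i j, Path (A i) (B j + TE.emb (N i j)))
    (hN : ∀ i j k l, (N i j).1 * (N k l).2 = (N i j).2 * (N k l).1)
    (h : ∀ i j k l, i ≠ k → j ≠ l → ∀ s t, ∀ n : ℤ × ℤ, g i j s - g k l t ≠ TE.emb n) :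
    False := by
  obtain ⟨p1, p2, u, v, hbz, hp⟩ : ∃ p1 p2 u v : ℤ, u * p1 + v * p2 = 1 ∧
      ∀ i j, p1 * (N i j).2 = p2 * (N i j).1 := by
    by_cases h0 : ∀ i j, N i j = 0
    · exact ⟨1, 0, 1, 0, by norm_num, fun i j => by simp [h0]⟩
    · push Not at h0
      obtain ⟨i0, j0, h0⟩ := h0
      have hg : Int.gcd (N i0 j0).1 (N i0 j0).2 ≠ 0 := by
        intro hh
        rw [Int.gcd_eq_zero_iff] at hh
        exact h0 (Prod.ext hh.1 hh.2)
      obtain ⟨d, hd⟩ : ∃ d : ℤ, d = ((Int.gcd (N i0 j0).1 (N i0 j0).2 : ℕ) : ℤ) := ⟨_, rfl⟩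
      have hd0 : d ≠ 0 := by rw [hd]; exact_mod_cast hg
      obtain ⟨a, ha⟩ : d ∣ (N i0 j0).1 := hd ▸ Int.gcd_dvd_left ..
      obtain ⟨b, hb⟩ : d ∣ (N i0 j0).2 := hd ▸ Int.gcd_dvd_right ..
      have hbez := Int.gcd_eq_gcd_ab (N i0 j0).1 (N i0 j0).2
      refine ⟨a, b, Int.gcdA (N i0 j0).1 (N i0 j0).2, Int.gcdB (N i0 j0).1 (N i0 j0).2, ?_, ?_⟩
      · apply mul_left_cancel₀ hd0
        rw [← hd] at hbez
        linear_combination -hbez - (Int.gcdA (N i0 j0).1 (N i0 j0).2) * ha - (Int.gcdB (N i0 j0).1 (N i0 j0).2) * hb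
      · intro i j
        apply mul_left_cancel₀ hd0
        linear_combination hN i0 j0 i j - (N i j).2 * ha + (N i j).1 * hb
  let Φ : ℝ × ℝ → ℂ := fun z => exp (((p1 * z.2 - p2 * z.1 : ℝ) : ℂ) +
    2 * Real.pi * I * ((u * z.1 + v * z.2 : ℝ) : ℂ))
  have hΦc : Continuous Φ := by fun_prop
  have hΦN : ∀ i j, Φ (B j + TE.emb (N i j)) = Φ (B j) := by
    intro i j
    simp only [Φ]
    rw [exp_eq_exp_iff_exists_int]
    refine ⟨u * (N i j).1 + v * (N i j).2, ?_⟩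
    have : (p1 * (N i j).2 : ℂ) = p2 * (N i j).1 := by exact_mod_cast hp i j
    simp only [TE.emb, Prod.fst_add, Prod.snd_add]
    push_cast
    linear_combination this
  have hΦ : ∀ z w, Φ z = Φ w → ∃ n : ℤ × ℤ, z - w = TE.emb n := by
    intro z w hzw
    obtain ⟨k, hk⟩ := exp_eq_exp_iff_exists_int.1 hzw
    have hre := congrArg re hk
    have him := congrArg im hk
    simp at hre him
    have h1 : u * z.1 + v * z.2 - (u * w.1 + v * w.2) = k := by
      have : (2 * Real.pi) ≠ 0 := by positivity
      apply mul_left_cancel₀ this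
      linear_combination him
    have hb : (u * p1 + v * p2 : ℝ) = 1 := by exact_mod_cast hbz
    refine ⟨(k * p1, k * p2), Prod.ext ?_ ?_⟩
    · simp only [TE.emb, Prod.fst_sub]
      push_cast
      linear_combination p1 * h1 - (z.1 - w.1) * hb - v * hre
    · simp only [TE.emb, Prod.snd_sub]
      push_cast
      linear_combination p2 * h1 - (z.2 - w.2) * hb + u * hre
  refine TE.planar (fun i => Φ (A i)) (fun j => Φ (B j))
    (fun i j => ((g i j).map hΦc).cast rfl (hΦN i j).symm) ?_
  intro i j k l hik hjl s t hst
  obtain ⟨n, hn⟩ := hΦ _ _ hst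
  exact h i j k l hik hjl s t n hn

/-- the projection from the plane to the torus -/
def TE.proj (z : ℝ × ℝ) : Torus := ((z.1 : UnitAddCircle), (z.2 : UnitAddCircle))

theorem TE.coe_eq (x y : ℝ) : (x : UnitAddCircle) = (y : UnitAddCircle) ↔
    ∃ n : ℤ, x - y = n := by
  rw [← sub_eq_zero, ← AddCircle.coe_sub, AddCircle.coe_eq_zero_iff]
  simp [eq_comm]

theorem TE.proj_eq (z w : ℝ × ℝ) : TE.proj z = TE.proj w ↔ ∃ n, z - w = TE.emb n := by
  simp only [TE.proj, Prod.ext_iff, TE.coe_eq, TE.emb, Prod.fst_sub, Prod.snd_sub, Prod.exists]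
  constructor
  · rintro ⟨⟨a, ha⟩, b, hb⟩
    exact ⟨a, b, ha, hb⟩
  · rintro ⟨a, b, ha, hb⟩
    exact ⟨⟨a, ha⟩, b, hb⟩

theorem TE.proj_add_emb (z : ℝ × ℝ) (n : ℤ × ℤ) : TE.proj (z + TE.emb n) = TE.proj z :=
  (TE.proj_eq _ _).2 ⟨n, by simp⟩

theorem TE.proj_surj (x : Torus) : ∃ z, TE.proj z = x := by
  obtain ⟨x, y⟩ := x
  obtain ⟨a, rfl⟩ := QuotientAddGroup.mk_surjective x
  obtain ⟨b, rfl⟩ := QuotientAddGroup.mk_surjective y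
  exact ⟨(a, b), rfl⟩

theorem TE.lift_path (p : C(unitInterval, Torus)) (z : ℝ × ℝ) (hz : TE.proj z = p 0) :
    ∃ q : C(unitInterval, ℝ × ℝ), q 0 = z ∧ ∀ t, TE.proj (q t) = p t := by
  have cov := AddCircle.isCoveringMap_coe (1 : ℝ)
  obtain ⟨q1, h1, h1'⟩ := cov.exists_path_lifts ⟨fun t => (p t).1, by fun_prop⟩ z.1
    (congrArg Prod.fst hz).symm
  obtain ⟨q2, h2, h2'⟩ := cov.exists_path_lifts ⟨fun t => (p t).2, by fun_prop⟩ z.2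
    (congrArg Prod.snd hz).symm
  refine ⟨⟨fun t => (q1 t, q2 t), by fun_prop⟩, Prod.ext h1' h2', fun t => ?_⟩
  exact Prod.ext (congrFun h1 t) (congrFun h2 t)

theorem TE.normalized_lift (a b : Fin 3 → Torus) (p : ∀ i j, Path (a i) (b j)) :
    ∃ (A B : Fin 3 → ℝ × ℝ) (N : Fin 3 → Fin 3 → ℤ × ℤ)
      (g : ∀ i j, Path (A i) (B j + TE.emb (N i j))),
      (∀ i j s, TE.proj (g i j s) = p i j s) ∧ (∀ j, N 0 j = 0) ∧ (∀ i, N i 0 = 0) := by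
  choose A hA using fun i => TE.proj_surj (a i)
  choose B hB using fun i => TE.proj_surj (b i)
  choose q hq0 hq using fun i j => TE.lift_path (p i j) (A i) (by simp [hA])
  have hn : ∀ i j, ∃ n : ℤ × ℤ, q i j 1 - B j = TE.emb n := by
    intro i j
    rw [← TE.proj_eq, hq, hB]
    simp
  choose n hn using hn
  refine ⟨fun i => A i + TE.emb (n 0 0 - n i 0), fun j => B j + TE.emb (n 0 j),
    fun i j => n i j + n 0 0 - n i 0 - n 0 j,
    fun i j => ⟨⟨fun t => q i j t + TE.emb (n 0 0 - n i 0), by fun_prop⟩, ?_, ?_⟩, ?_, ?_, ?_⟩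
  · simp [hq0]
  · have := hn i j
    rw [sub_eq_iff_eq_add] at this
    simp only [this, TE.emb_sub, TE.emb_add]
    abel
  · intro i j s
    exact (TE.proj_add_emb _ _).trans (hq i j s)
  · intro j
    simp
  · intro i
    simp

theorem TE.joined_translate {S : Set Torus} {x y : ℝ × ℝ} (h : JoinedIn (TE.proj ⁻¹' S) x y)
    (n : ℤ × ℤ) : JoinedIn (TE.proj ⁻¹' S) (x + TE.emb n) (y + TE.emb n) := by
  obtain ⟨γ, hγ⟩ := h
  refine ⟨γ.map (f := fun z => z + TE.emb n) (by fun_prop), fun t => ?_⟩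
  have := hγ t
  simp only [Set.mem_preimage, Path.map_coe, Function.comp_apply, TE.proj_add_emb] at this ⊢
  exact this

theorem TE.loops {a b : Fin 3 → Torus} (p : ∀ i j, Path (a i) (b j))
    (A B : Fin 3 → ℝ × ℝ) (N : Fin 3 → Fin 3 → ℤ × ℤ)
    (g : ∀ i j, Path (A i) (B j + TE.emb (N i j)))
    (hg : ∀ i j s, TE.proj (g i j s) = p i j s) (h0 : ∀ j, N 0 j = 0) (h1 : ∀ i, N i 0 = 0)
    (i j : Fin 3) : ∃ q : C(unitInterval, ℝ × ℝ), q 1 = q 0 + TE.emb (-N i j) ∧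
      ∀ s, ∃ i' j' t, TE.proj (q s) = p i' j' t := by
  let S : Set Torus := {x | ∃ i' j' t, x = p i' j' t}
  have e0 : TE.emb 0 = 0 := by simp [TE.emb]
  have J : ∀ i j, JoinedIn (TE.proj ⁻¹' S) (A i) (B j + TE.emb (N i j)) :=
    fun i j => ⟨g i j, fun t => ⟨i, j, t, hg i j t⟩⟩
  have j1 := J 0 j
  have j2 := TE.joined_translate (J i j).symm (-N i j)
  have j3 := TE.joined_translate (J i 0) (-N i j)
  have j4 := TE.joined_translate (J 0 0).symm (-N i j)
  rw [h0, e0, add_zero] at j1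
  rw [add_assoc, ← TE.emb_add, add_neg_cancel, e0, add_zero] at j2
  rw [h1, e0, add_zero] at j3
  rw [h1, e0, add_zero] at j4
  obtain ⟨γ, hγ⟩ := ((j1.trans j2).trans j3).trans j4
  exact ⟨γ, by simp, fun s => hγ s⟩

theorem TE.main (a b a' b' : Fin 3 → Torus) (p : ∀ i j, Path (a i) (b j))
    (p' : ∀ i j, Path (a' i) (b' j))
    (h : ∀ i j k l, i ≠ k → j ≠ l → ∀ s t, p i j s ≠ p k l t)
    (h' : ∀ i j k l, i ≠ k → j ≠ l → ∀ s t, p' i j s ≠ p' k l t)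
    (hh : ∀ i j k l s t, p i j s ≠ p' k l t) : False := by
  obtain ⟨A, B, N, g, hg, h0, h1⟩ := TE.normalized_lift a b p
  obtain ⟨A', B', N', g', hg', h0', h1'⟩ := TE.normalized_lift a' b' p'
  have hdet : ∀ i j k l, (N i j).1 * (N' k l).2 = (N i j).2 * (N' k l).1 := by
    intro i j k l
    obtain ⟨q, hq, hqs⟩ := TE.loops p A B N g hg h0 h1 i j
    obtain ⟨q', hq', hqs'⟩ := TE.loops p' A' B' N' g' hg' h0' h1' k l
    have := TE.det_zero q q' _ _ hq hq' (by
      intro s t n hn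
      obtain ⟨i1, j1, t1, e1⟩ := hqs s
      obtain ⟨i2, j2, t2, e2⟩ := hqs' t
      have := (TE.proj_eq _ _).2 ⟨n, hn⟩
      rw [e1, e2] at this
      exact hh _ _ _ _ _ _ this)
    simpa using this
  by_cases hz : ∀ k l, N' k l = 0
  · refine TE.annulus A' B' N' g' (by simp [hz]) ?_
    intro i j k l hik hjl s t n hn
    have := (TE.proj_eq _ _).2 ⟨n, hn⟩
    rw [hg', hg'] at this
    exact h' _ _ _ _ hik hjl _ _ this
  · push Not at hz
    obtain ⟨k0, l0, hz⟩ := hz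
    refine TE.annulus A B N g ?_ ?_
    · intro i j k l
      have d1 := hdet i j k0 l0
      have d2 := hdet k l k0 l0
      by_cases hx : (N' k0 l0).1 = 0
      · have hy : (N' k0 l0).2 ≠ 0 := fun hy => hz (Prod.ext hx hy)
        apply mul_left_cancel₀ hy
        linear_combination (N k l).2 * d1 - (N i j).2 * d2
      · apply mul_left_cancel₀ hx
        linear_combination (N k l).1 * d1 - (N i j).1 * d2
    · intro i j k l hik hjl s t n hn
      have := (TE.proj_eq _ _).2 ⟨n, hn⟩
      rw [hg, hg] at this
      exact h _ _ _ _ hik hjl _ _ this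

theorem TE.oriented {V : Type} {G : SimpleGraph V} (φ : TorusEmbedding G) (u v : V)
    (huv : G.Adj u v) : ∃ p : Path (φ.vert u) (φ.vert v),
      ∀ s, ∃ t, p s = φ.edge ⟨s(u, v), huv⟩ t := by
  obtain ⟨x, y, hxy, h0, h1⟩ := φ.edge_ends ⟨s(u, v), huv⟩
  let q : Path (φ.vert x) (φ.vert y) := ⟨φ.edge ⟨s(u, v), huv⟩, h0, h1⟩
  simp only [Sym2.eq_iff] at hxy
  rcases hxy with ⟨rfl, rfl⟩ | ⟨rfl, rfl⟩
  · exact ⟨q, fun s => ⟨s, rfl⟩⟩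
  · exact ⟨q.symm, fun s => ⟨unitInterval.symm s, rfl⟩⟩

/-- There is no embedding of `E₄₂ = K_{3,3} ⊔ K_{3,3}` into the torus. -/
theorem no_toroidal_embedding_of_E42 : IsEmpty (TorusEmbedding E42) := by
  refine ⟨fun φ => ?_⟩
  have ad : ∀ i j, E42.Adj (.inl (.inl i)) (.inl (.inr j)) := fun i j => by simp
  have ad' : ∀ i j, E42.Adj (.inr (.inl i)) (.inr (.inr j)) := fun i j => by simp
  choose p hp using fun i j => TE.oriented φ _ _ (ad i j)
  choose p' hp' using fun i j => TE.oriented φ _ _ (ad' i j)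
  have dis : ∀ (e e' : E42.edgeSet), (∀ w, w ∈ e.1 → w ∉ e'.1) →
      ∀ s t, φ.edge e s ≠ φ.edge e' t := by
    intro e e' hw s t hst
    obtain ⟨w, h1, h2, _⟩ := φ.edge_disjoint e e' (by
      rintro rfl
      exact hw _ (Sym2.out_fst_mem _) (Sym2.out_fst_mem _)) s t hst
    exact hw w h1 h2
  refine TE.main _ _ _ _ p p' ?_ ?_ ?_
  · intro i j k l hik hjl s t
    obtain ⟨s', hs⟩ := hp i j s
    obtain ⟨t', ht⟩ := hp k l t
    rw [hs, ht]
    apply dis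
    intro w h1 h2
    simp only [Sym2.mem_iff] at h1 h2
    clear hs ht hp hp' dis
    rcases h1 with rfl | rfl <;> simp at h2 <;> grind
  · intro i j k l hik hjl s t
    obtain ⟨s', hs⟩ := hp' i j s
    obtain ⟨t', ht⟩ := hp' k l t
    rw [hs, ht]
    apply dis
    intro w h1 h2
    simp only [Sym2.mem_iff] at h1 h2
    clear hs ht hp hp' dis
    rcases h1 with rfl | rfl <;> simp at h2 <;> grind
  · intro i j k l s t
    obtain ⟨s', hs⟩ := hp i j s
    obtain ⟨t', ht⟩ := hp' k l t
    rw [hs, ht]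
    apply dis
    intro w h1 h2
    simp only [Sym2.mem_iff] at h1 h2
    clear hs ht hp hp' dis
    rcases h1 with rfl | rfl <;> simp at h2 <;> grind
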